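/- arXiv:2503.23582 — 5 statements merged into one kernel-verified Lean document; each statement's English description precedes it below -/
import Mathlib

section
/- Let p, q : ℕ → ℕ ∪ {0} be nondecreasing functions with p(1) = q(1) = 0, and suppose that for all n ∈ ℕ: (i) p(n+1) ≥ p(n) + q(n) + 1 and (ii) q(n+1) ≥ p(n+1) + q(n) + 1. Then p and q satisfy the sparseness conditions, and the sequence n ↦ q(n) − p(n) is nonnegative and nondecreasing. -/
/-- The sparseness conditions of Lemma 3.1 (`Brad`, Lemma 4.1): `p, q` are increasing
(on `n ≥ 1`), `p(1) = q(1) = 0`, and for all `i, j, k, l ≥ 1`: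
(a) for `r = p` or `r = q`, if `r(j) − r(k) = r(l) − r(i)` then `(i = k ∧ j = l)` or
`(j = k ∧ i = l)`; (b) if `q(j) − p(k) = q(l) − p(i)` then `i = k ∧ j = l`. -/
def SparseConds (p q : ℕ → ℕ) : Prop :=
  (∀ ⦃m n : ℕ⦄, 1 ≤ m → m < n → p m < p n) ∧
  (∀ ⦃m n : ℕ⦄, 1 ≤ m → m < n → q m < q n) ∧
  p 1 = 0 ∧ q 1 = 0 ∧
  (∀ i j k l : ℕ, 1 ≤ i → 1 ≤ j → 1 ≤ k → 1 ≤ l →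
    (((p j : ℤ) - (p k : ℤ) = (p l : ℤ) - (p i : ℤ)) → (i = k ∧ j = l) ∨ (j = k ∧ i = l)) ∧
    (((q j : ℤ) - (q k : ℤ) = (q l : ℤ) - (q i : ℤ)) → (i = k ∧ j = l) ∨ (j = k ∧ i = l)) ∧
    (((q j : ℤ) - (p k : ℤ) = (q l : ℤ) - (p i : ℤ)) → (i = k ∧ j = l)))

/-- A sequence of naturals that more than doubles at every step is a Sidon sequence on `n ≥ 1`. -/
theorem sidon_of_two_mul_lt {r : ℕ → ℕ} (hr : ∀ ⦃m n : ℕ⦄, 1 ≤ m → m < n → 2 * r m < r n)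
    {i j k l : ℕ} (hi : 1 ≤ i) (hj : 1 ≤ j) (hk : 1 ≤ k) (hl : 1 ≤ l)
    (h : r j + r i = r l + r k) : (i = k ∧ j = l) ∨ (j = k ∧ i = l) := by
  have hinj : ∀ m n, 1 ≤ m → 1 ≤ n → r m = r n → m = n := by
    intro m n hm hn hmn
    rcases lt_trichotomy m n with hlt | heq | hgt
    · have := hr hm hlt
      omega
    · exact heq
    · have := hr hn hgt
      omega
  by_cases hik : i = k
  · subst hik
    exact Or.inl ⟨rfl, hinj _ _ hj hl (by omega)⟩
  by_cases hil : i = l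
  · subst hil
    exact Or.inr ⟨hinj _ _ hj hk (by omega), rfl⟩
  by_cases hjk : j = k
  · subst hjk
    exact absurd (hinj _ _ hi hl (by omega)) hil
  by_cases hjl : j = l
  · subst hjl
    exact absurd (hinj _ _ hi hk (by omega)) hik
  exfalso
  have compare : ∀ m n, 1 ≤ m → 1 ≤ n → m ≠ n → 2 * r m < r n ∨ 2 * r n < r m := by
    intro m n hm hn hne
    rcases lt_or_gt_of_ne hne with hlt | hgt
    · exact Or.inl (hr hm hlt)
    · exact Or.inr (hr hn hgt)
  have := compare i k hi hk hik
  have := compare i l hi hl hil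
  have := compare j k hj hk hjk
  have := compare j l hj hl hjl
  omega

/-- If `p, q : ℕ → ℕ` are nondecreasing with `p(1) = q(1) = 0` and satisfy
(i) `p(n+1) ≥ p(n) + q(n) + 1` and (ii) `q(n+1) ≥ p(n+1) + q(n) + 1` for all `n ≥ 1`, then
`p, q` satisfy the sparseness conditions and `n ↦ q(n) − p(n)` is nonnegative and
nondecreasing. -/
theorem stmt6 (p q : ℕ → ℕ)
    (hpmono : ∀ ⦃m n : ℕ⦄, 1 ≤ m → m ≤ n → p m ≤ p n)
    (hqmono : ∀ ⦃m n : ℕ⦄, 1 ≤ m → m ≤ n → q m ≤ q n)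
    (hp1 : p 1 = 0) (hq1 : q 1 = 0)
    (hrec1 : ∀ n : ℕ, 1 ≤ n → p n + q n + 1 ≤ p (n + 1))
    (hrec2 : ∀ n : ℕ, 1 ≤ n → p (n + 1) + q n + 1 ≤ q (n + 1)) :
    SparseConds p q ∧ (∀ n : ℕ, 1 ≤ n → p n ≤ q n) ∧
      (∀ ⦃m n : ℕ⦄, 1 ≤ m → m ≤ n → q m - p m ≤ q n - p n) := by
  have hle : ∀ n : ℕ, 1 ≤ n → p n ≤ q n := by
    intro n hn
    induction n, hn using Nat.le_induction with
    | base => omega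
    | succ n hn _ =>
      have := hrec2 n hn
      omega
  have hp : ∀ ⦃m n : ℕ⦄, 1 ≤ m → m < n → p m + q m + 1 ≤ p n := fun m n hm hmn =>
    (hrec1 m hm).trans (hpmono (by omega) hmn)
  have hq : ∀ ⦃m n : ℕ⦄, 1 ≤ m → m < n → p n + q m + 1 ≤ q n := by
    intro m n hm hmn
    obtain ⟨t, rfl⟩ : ∃ t, n = t + 1 := ⟨n - 1, by omega⟩
    have := hrec2 t (by omega)
    have := hqmono hm (Nat.le_of_lt_succ hmn)
    omega
  have hpp : ∀ ⦃m n : ℕ⦄, 1 ≤ m → m < n → 2 * p m < p n := by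
    intro m n hm hmn
    have := hp hm hmn
    have := hle m hm
    omega
  have hqq : ∀ ⦃m n : ℕ⦄, 1 ≤ m → m < n → 2 * q m < q n := by
    intro m n hm hmn
    have := hp hm hmn
    have := hq hm hmn
    omega
  have hcross : ∀ i j k l : ℕ, 1 ≤ i → 1 ≤ j → 1 ≤ k → 1 ≤ l → l < j →
      q j + p i ≠ q l + p k := by
    intro i j k l hi hj hk hl hlj h
    have hqlj := hq hl hlj
    rcases le_or_gt k j with hkj | hjk
    · have := hpmono hk hkj
      omega
    · obtain ⟨t, rfl⟩ : ∃ t, k = t + 1 := ⟨k - 1, by omega⟩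
      have hstep := hrec1 t (by omega)
      have hqjt := hqmono hj (Nat.le_of_lt_succ hjk)
      rcases le_or_gt i t with hit | hti
      · have := hpmono hi hit
        omega
      · have := hpmono hk (show t + 1 ≤ i from hti)
        omega
  refine ⟨⟨?_, ?_, hp1, hq1, ?_⟩, hle, ?_⟩
  · intro m n hm hmn
    have := hpp hm hmn
    omega
  · intro m n hm hmn
    have := hqq hm hmn
    omega
  · intro i j k l hi hj hk hl
    refine ⟨fun h => sidon_of_two_mul_lt hpp hi hj hk hl (by omega),
      fun h => sidon_of_two_mul_lt hqq hi hj hk hl (by omega), fun h => ?_⟩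
    rcases lt_trichotomy l j with hlj | rfl | hjl
    · exact absurd (by omega) (hcross i j k l hi hj hk hl hlj)
    · refine ⟨?_, rfl⟩
      rcases lt_trichotomy i k with hik | heq | hki
      · have := hpp hi hik
        omega
      · exact heq
      · have := hpp hk hki
        omega
    · exact absurd (by omega) (hcross k l i j hk hl hi hj hjl)
  · intro m n hm hmn
    rcases hmn.eq_or_lt with rfl | hlt
    · exact le_rfl
    · have := hq hm hlt
      omega
end

section
/- Suppose Δ is a lawless group and for each l ∈ ℕ the elements g_l, h_l ∈ Δ are such that v(g_l, h_l) ≠ e for every nontrivial v ∈ F_2 with |v| ≤ l. Then for any unbounded nondecreasing function L : ℕ → ℕ and any p, q satisfying the sparseness conditions, the associated sparse wreath product Γ is not residually finite. -/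
/-- The length of the reduced word representing an element of the free group. -/
def wordLen {k : ℕ} (w : FreeGroup (Fin k)) : ℕ := w.toWord.length

/-- `w ∈ F_k` is a law for `Γ` if it vanishes under every evaluation in `Γ`. -/
def IsLaw (Γ : Type*) [Group Γ] {k : ℕ} (w : FreeGroup (Fin k)) : Prop :=
  ∀ g : Fin k → Γ, FreeGroup.lift g w = 1

/-- A group is lawless if for every `k` no nontrivial element of `F_k` is a law for it. -/
def IsLawless (Γ : Type*) [Group Γ] : Prop :=
  ∀ (k : ℕ) (w : FreeGroup (Fin k)), w ≠ 1 → ¬ IsLaw Γ w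

/-- A group is residually finite if every nontrivial element survives in some finite
quotient. -/
def IsResiduallyFinite (Γ : Type*) [Group Γ] : Prop :=
  ∀ g : Γ, g ≠ 1 → ∃ (H : Type) (_ : Group H) (_ : Finite H) (φ : Γ →* H), φ g ≠ 1

/-- The shift automorphism of `Δ^ℤ` by `k`. -/
def shiftEquiv' (Δ : Type*) [Group Δ] (k : ℤ) : (ℤ → Δ) ≃* (ℤ → Δ) where
  toFun f := fun m => f (m - k)
  invFun f := fun m => f (m + k)
  left_inv f := by funext m; simp
  right_inv f := by funext m; simp
  map_mul' f g := rfl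

/-- The action of `ℤ` on `Δ^ℤ` by shifts. -/
def shiftHom (Δ : Type*) [Group Δ] : Multiplicative ℤ →* MulAut (ℤ → Δ) :=
  MonoidHom.mk' (fun k => shiftEquiv' Δ k.toAdd) (by
    intro a b
    ext f m
    show f (m - (a * b).toAdd) = f (m - a.toAdd - b.toAdd)
    rw [toAdd_mul, sub_sub])

/-- The unrestricted wreath product `Δ Wr ℤ = Δ^ℤ ⋊ ℤ`, with `ℤ` acting by shifts. -/
abbrev WrZ (Δ : Type*) [Group Δ] : Type _ :=
  SemidirectProduct (ℤ → Δ) (Multiplicative ℤ) (shiftHom Δ)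

/-- The copy of `f : ℤ → Δ` inside `Δ Wr ℤ`. -/
def inlW {Δ : Type*} [Group Δ] (f : ℤ → Δ) : WrZ Δ := SemidirectProduct.inl f

/-- The generator `t` of the acting copy of `ℤ` in `Δ Wr ℤ`. -/
def tW (Δ : Type*) [Group Δ] : WrZ Δ := SemidirectProduct.inr (Multiplicative.ofAdd 1)

/-- The generating set `S(L) = {ĝ, ĥ, t}` of the sparse wreath product. -/
def SWPgens {Δ : Type*} [Group Δ] (ghat hhat : ℤ → Δ) : Set (WrZ Δ) :=
  {inlW ghat, inlW hhat, tW Δ}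

/-- The sparse wreath product `Γ = ⟨ĝ, ĥ, t⟩ ≤ Δ Wr ℤ`. -/
def SWP {Δ : Type*} [Group Δ] (ghat hhat : ℤ → Δ) : Subgroup (WrZ Δ) :=
  Subgroup.closure (SWPgens ghat hhat)

open scoped commutatorElement

section

variable {Δ : Type*} [Group Δ]

lemma tW_zpow (k : ℤ) :
    tW Δ ^ k = SemidirectProduct.inr (Multiplicative.ofAdd k) := by
  rw [tW, ← map_zpow, ← ofAdd_zsmul, smul_eq_mul, mul_one]

lemma tW_zpow_conj_inlW (k : ℤ) (f : ℤ → Δ) :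
    tW Δ ^ k * inlW f * (tW Δ ^ k)⁻¹ = inlW (fun m => f (m - k)) := by
  rw [tW_zpow, inlW, ← map_inv, ← SemidirectProduct.inl_aut]
  rfl

lemma inlW_commutatorElement (a b : ℤ → Δ) : inlW ⁅a, b⁆ = ⁅inlW a, inlW b⁆ :=
  map_commutatorElement SemidirectProduct.inl a b

lemma shift_mem {S : Subgroup (WrZ Δ)} (ht : tW Δ ∈ S) {f : ℤ → Δ} (hf : inlW f ∈ S)
    (k : ℤ) : inlW (fun m => f (m - k)) ∈ S := by
  rw [← tW_zpow_conj_inlW]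
  exact S.mul_mem (S.mul_mem (S.zpow_mem ht k) hf) (S.inv_mem (S.zpow_mem ht k))

/-- In a subgroup of `Δ Wr ℤ` containing `t`, two elements supported at the origin have commuting
images in every finite quotient. -/
lemma commute_map_of_supported_zero {S : Subgroup (WrZ Δ)} (ht : tW Δ ∈ S) {a b : ℤ → Δ}
    (ha : inlW a ∈ S) (hb : inlW b ∈ S) (ha0 : ∀ m ≠ 0, a m = 1) (hb0 : ∀ m ≠ 0, b m = 1)
    {H : Type*} [Group H] [Finite H] (φ : S →* H) :
    Commute (φ ⟨inlW a, ha⟩) (φ ⟨inlW b, hb⟩) := by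
  set N : ℤ := (Nat.card H : ℤ) with hN
  have hN0 : N ≠ 0 := by
    rw [hN]
    exact_mod_cast Nat.card_pos.ne'
  have hφt : φ (⟨tW Δ, ht⟩ ^ N) = 1 := by
    rw [map_zpow, hN, zpow_natCast, pow_card_eq_one']
  have hshift : (⟨inlW (fun m => a (m - N)), shift_mem ht ha N⟩ : S) =
      ⟨tW Δ, ht⟩ ^ N * ⟨inlW a, ha⟩ * (⟨tW Δ, ht⟩ ^ N)⁻¹ := by
    ext1
    simpa using (tW_zpow_conj_inlW N a).symm
  have hφa : φ ⟨inlW a, ha⟩ = φ ⟨inlW (fun m => a (m - N)), shift_mem ht ha N⟩ := by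
    rw [hshift, map_mul, map_mul, map_inv, hφt, one_mul, inv_one, mul_one]
  rw [hφa]
  refine Commute.map (?_ : Commute _ _) φ
  have hcomm : Commute (fun m => a (m - N)) b := by
    funext m
    rcases eq_or_ne m 0 with rfl | hm
    · simp [ha0 (-N) (neg_ne_zero.mpr hN0)]
    · simp [hb0 m hm]
  exact Subtype.ext (hcomm.map (SemidirectProduct.inl : (ℤ → Δ) →* WrZ Δ))

end

/-- If `Δ` is lawless and `g_l, h_l ∈ Δ` satisfy `v(g_l, h_l) ≠ e` for all
nontrivial `v ∈ F₂` with `|v| ≤ l`, then for any unbounded nondecreasing `L` and any `p, q`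
satisfying the sparseness conditions, the associated sparse wreath product is not
residually finite. -/
theorem stmt8 (Δ : Type*) [Group Δ] (hΔ : IsLawless Δ)
    (g h : ℕ → Δ)
    (hgh : ∀ (l : ℕ) (v : FreeGroup (Fin 2)), v ≠ 1 → wordLen v ≤ l →
      FreeGroup.lift (fun i : Fin 2 => if i = 0 then g l else h l) v ≠ 1)
    (L : ℕ → ℕ)
    (hLmono : ∀ ⦃m n : ℕ⦄, 1 ≤ m → m ≤ n → L m ≤ L n)
    (hLunb : ∀ N : ℕ, ∃ n : ℕ, 1 ≤ n ∧ N ≤ L n)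
    (p q : ℕ → ℕ) (hpq : SparseConds p q)
    (ghat hhat : ℤ → Δ)
    (hghat : ∀ n : ℕ, 1 ≤ n → ghat ((p n : ℕ) : ℤ) = g (L n))
    (hghat' : ∀ m : ℤ, (∀ n : ℕ, 1 ≤ n → m ≠ ((p n : ℕ) : ℤ)) → ghat m = 1)
    (hhhat : ∀ n : ℕ, 1 ≤ n → hhat ((q n : ℕ) : ℤ) = h (L n))
    (hhhat' : ∀ m : ℤ, (∀ n : ℕ, 1 ≤ n → m ≠ ((q n : ℕ) : ℤ)) → hhat m = 1) :
    ¬ IsResiduallyFinite (SWP ghat hhat) := by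
  set v : FreeGroup (Fin 2) :=
    ⁅⁅FreeGroup.of (0 : Fin 2), FreeGroup.of (1 : Fin 2)⁆,
      FreeGroup.of (0 : Fin 2) * ⁅FreeGroup.of (0 : Fin 2), FreeGroup.of (1 : Fin 2)⁆ *
        (FreeGroup.of (0 : Fin 2))⁻¹⁆ with hv
  have hv1 : v ≠ 1 := by rw [hv]; decide
  obtain ⟨n, hn, hLn⟩ := hLunb (wordLen v)
  have hvn := hgh (L n) v hv1 hLn
  obtain ⟨-, -, -, -, hsparse⟩ := hpq
  set S := SWP ghat hhat with hS
  have ht : tW Δ ∈ S := Subgroup.subset_closure (by simp [SWPgens])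
  have hg : inlW ghat ∈ S := Subgroup.subset_closure (by simp [SWPgens])
  have hh : inlW hhat ∈ S := Subgroup.subset_closure (by simp [SWPgens])
  set u : ℤ → Δ := fun m => ghat (m - -(p n : ℤ)) with hu
  set w : ℤ → Δ := fun m => hhat (m - -(q n : ℤ)) with hw
  have huS : inlW u ∈ S := shift_mem ht hg _
  have hwS : inlW w ∈ S := shift_mem ht hh _
  have hu0 : u 0 = g (L n) := by simp [hu, hghat n hn]
  have hw0 : w 0 = h (L n) := by simp [hw, hhhat n hn]
  have ha0 : ∀ m ≠ 0, ⁅u, w⁆ m = 1 := by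
    intro m hm
    have huw : u m = 1 ∨ w m = 1 := by
      by_contra! hne
      obtain ⟨k, hk, hmk⟩ : ∃ k : ℕ, 1 ≤ k ∧ m - -(p n : ℤ) = (p k : ℤ) := by
        by_contra! hcon
        exact hne.1 (hghat' _ hcon)
      obtain ⟨j, hj, hmj⟩ : ∃ j : ℕ, 1 ≤ j ∧ m - -(q n : ℤ) = (q j : ℤ) := by
        by_contra! hcon
        exact hne.2 (hhhat' _ hcon)
      obtain ⟨rfl, -⟩ := (hsparse n j k n hn hj hk hn).2.2 (by lia)
      lia
    change ⁅u m, w m⁆ = 1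
    rcases huw with hm1 | hm1 <;> simp [hm1]
  have haS : inlW ⁅u, w⁆ ∈ S := by
    rw [inlW_commutatorElement]
    exact S.mul_mem (S.mul_mem (S.mul_mem huS hwS) (S.inv_mem huS)) (S.inv_mem hwS)
  have hb0 : ∀ m ≠ 0, (u * ⁅u, w⁆ * u⁻¹) m = 1 := by
    intro m hm
    simp [ha0 m hm]
  have hbS : inlW (u * ⁅u, w⁆ * u⁻¹) ∈ S := by
    have := S.mul_mem (S.mul_mem huS haS) (S.inv_mem huS)
    simpa [inlW] using this
  intro hRF
  obtain ⟨H, _, _, φ, hφ⟩ :=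
    hRF ⁅(⟨inlW ⁅u, w⁆, haS⟩ : S), ⟨inlW (u * ⁅u, w⁆ * u⁻¹), hbS⟩⁆ (by
      intro hc
      apply hvn
      have hc' : inlW ⁅⁅u, w⁆, u * ⁅u, w⁆ * u⁻¹⁆ = 1 := by
        rw [inlW_commutatorElement]
        exact congrArg Subtype.val hc
      have hc0 := congrFun (congrArg SemidirectProduct.left hc') 0
      change ⁅⁅u 0, w 0⁆, u 0 * ⁅u 0, w 0⁆ * (u 0)⁻¹⁆ = 1 at hc0
      rw [hu0, hw0] at hc0
      simpa [hv, map_commutatorElement] using hc0)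
  apply hφ
  rw [map_commutatorElement, commutatorElement_eq_one_iff_commute]
  exact commute_map_of_supported_zero ht haS hbS ha0 hb0 φ
end

section
/- Let p be a prime and let α(PSL_2(p)) denote the minimal length |w| of a nontrivial word w ∈ F_k (over all k ≥ 1) that is a law for PSL_2(p). Then (p − 1)/3 ≤ α(PSL_2(p)) ≤ 8p + 6. -/
/-- `SL₂(𝔽_p)`. -/
abbrev SL2 (p : ℕ) : Type := Matrix.SpecialLinearGroup (Fin 2) (ZMod p)

/-- `PSL₂(p)`, the quotient of `SL₂(𝔽_p)` by its center. -/
abbrev PSL2 (p : ℕ) : Type := SL2 p ⧸ Subgroup.center (SL2 p)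

/-- `α(Γ)`, the minimal length of a nontrivial law (in any number of variables) for `Γ`. -/
noncomputable def alphaLaw (Γ : Type*) [Group Γ] : ℕ :=
  sInf {n | ∃ (k : ℕ) (w : FreeGroup (Fin k)), 1 ≤ k ∧ w ≠ 1 ∧ IsLaw Γ w ∧ wordLen w = n}

/-- The transvection `1 + t N`, where `N` is the square-zero matrix with image spanned by
`(1, s)`. -/
def transv {K : Type*} [CommRing K] (s t : K) : Matrix.SpecialLinearGroup (Fin 2) K :=
  ⟨!![1 - t * s, t; -(t * s ^ 2), 1 + t * s], by rw [Matrix.det_fin_two_of]; ring⟩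

theorem transv_inv {K : Type*} [CommRing K] (s t : K) : (transv s t)⁻¹ = transv s (-t) := by
  ext i j
  rw [Matrix.SpecialLinearGroup.coe_inv]
  simp only [transv, Matrix.adjugate_fin_two_of]
  fin_cases i <;> fin_cases j <;> simp [sub_eq_add_neg]

/-- The sign `±1` of a letter `x` or `x⁻¹`. -/
def letterSign (K : Type*) [CommRing K] (ε : Bool) : K := cond ε 1 (-1)

theorem letterSign_ne_zero {K : Type*} [Field K] (ε : Bool) : letterSign K ε ≠ 0 := by
  cases ε <;> simp [letterSign]

theorem cond_transv {K : Type*} [CommRing K] (s t : K) (ε : Bool) :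
    cond ε (transv s t) (transv s t)⁻¹ = transv s (letterSign K ε * t) := by
  cases ε <;> simp [letterSign, transv_inv]

theorem transv_mul_apply_zero_one {K : Type*} [CommRing K] (s t : K)
    (g : Matrix.SpecialLinearGroup (Fin 2) K) :
    (transv s t * g) 0 1 = g 0 1 + t * (g 1 1 - s * g 0 1) := by
  rw [Matrix.SpecialLinearGroup.coe_mul, Matrix.mul_apply, Fin.sum_univ_two]
  simp [transv]
  ring

theorem transv_mul_apply_one_one {K : Type*} [CommRing K] (s t : K)
    (g : Matrix.SpecialLinearGroup (Fin 2) K) :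
    (transv s t * g) 1 1 = g 1 1 + t * s * (g 1 1 - s * g 0 1) := by
  rw [Matrix.SpecialLinearGroup.coe_mul, Matrix.mul_apply, Fin.sum_univ_two]
  simp [transv]
  ring

/-- The value of a word in the transvections `transv (s i) t`. -/
def transvEval {K ι : Type*} [CommRing K] (s : ι → K) (t : K) (L : List (ι × Bool)) :
    Matrix.SpecialLinearGroup (Fin 2) K :=
  (L.map fun x => transv (s x.1) (letterSign K x.2 * t)).prod

open Polynomial in
/-- The second column of a reduced word in transvections is `q + t m N q`, where `m` is the
exponent of the first syllable, `N` its square-zero matrix, and `q` is polynomial in `t` with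
leading coefficient outside the kernel of `N`. -/
theorem exists_transvEval_eq {p : ℕ} [Fact p.Prime] {ι : Type*} (s : ι → ZMod p)
    (L : List (ι × Bool)) : ∀ (i : ι) (ε : Bool),
    FreeGroup.IsReduced ((i, ε) :: L) → L.length + 1 < p →
    Set.InjOn s {j | j ∈ ((i, ε) :: L).map Prod.fst} →
    ∃ (m d : ℕ) (u v : (ZMod p)[X]), 0 < m ∧ m + d ≤ L.length + 1 ∧
      u.natDegree ≤ d ∧ v.natDegree ≤ d ∧ (v - C (s i) * u).coeff d ≠ 0 ∧
      ∀ t : ZMod p,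
        transvEval s t ((i, ε) :: L) 0 1 =
          (u + C (letterSign (ZMod p) ε * m) * X * (v - C (s i) * u)).eval t ∧
        transvEval s t ((i, ε) :: L) 1 1 =
          (v + C (letterSign (ZMod p) ε * m * s i) * X * (v - C (s i) * u)).eval t := by
  induction L with
  | nil =>
    intro i ε _ _ _
    refine ⟨1, 0, 0, 1, one_pos, by simp, by simp, by simp, by simp, fun t => ?_⟩
    have h (x : ι × Bool) : transvEval s t [x] = transv (s x.1) (letterSign _ x.2 * t) * 1 := by
      simp [transvEval]
    rw [h, transv_mul_apply_zero_one, transv_mul_apply_one_one]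
    simp
    ring
  | cons y L ih =>
    obtain ⟨j, δ⟩ := y
    intro i ε hred hlen hinj
    have hred' : FreeGroup.IsReduced ((j, δ) :: L) := (List.isChain_cons_cons.1 hred).2
    have hε : i = j → ε = δ := (List.isChain_cons_cons.1 hred).1
    simp only [List.length_cons] at hlen
    obtain ⟨m, d, u, v, hm, hmd, hu, hv, hc, he⟩ := ih j δ hred' (by omega)
      (hinj.mono fun x hx => by
        simp only [Set.mem_ofPred_eq, List.map_cons, List.mem_cons] at hx ⊢
        exact Or.inr hx)
    have hcons (t : ZMod p) : transvEval s t ((i, ε) :: (j, δ) :: L) =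
        transv (s i) (letterSign _ ε * t) * transvEval s t ((j, δ) :: L) := by
      simp [transvEval]
    by_cases hij : i = j
    · obtain rfl := hε hij
      subst hij
      refine ⟨m + 1, d, u, v, by omega, by simp only [List.length_cons]; omega, hu, hv, hc,
        fun t => ?_⟩
      rw [hcons, transv_mul_apply_zero_one, transv_mul_apply_one_one, (he t).1, (he t).2]
      simp
      constructor <;> ring
    · have hl : (v - C (s j) * u).natDegree ≤ d :=
        (natDegree_sub_le_of_le hv ((natDegree_C_mul_le _ _).trans hu)).trans (max_self d).le
      have hN (c : ZMod p) : (C c * X * (v - C (s j) * u)).natDegree ≤ d + 1 := by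
        rw [mul_assoc]
        refine (natDegree_C_mul_le _ _).trans (natDegree_mul_le.trans ?_)
        have := natDegree_X_le (R := ZMod p)
        omega
      have hm0 : (m : ZMod p) ≠ 0 := by
        rw [Ne, ZMod.natCast_eq_zero_iff]
        exact fun h => absurd (Nat.le_of_dvd hm h) (by omega)
      have hsij : s j - s i ≠ 0 := by
        rw [sub_ne_zero]
        exact fun h => hij (hinj (by simp) (by simp) h.symm)
      refine ⟨1, d + 1, u + C (letterSign (ZMod p) δ * m) * X * (v - C (s j) * u),
        v + C (letterSign (ZMod p) δ * m * s j) * X * (v - C (s j) * u), one_pos,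
        by simp only [List.length_cons]; omega,
        natDegree_add_le_of_degree_le (hu.trans d.le_succ) (hN _),
        natDegree_add_le_of_degree_le (hv.trans d.le_succ) (hN _), ?_, fun t => ?_⟩
      · have hu0 : u.coeff (d + 1) = 0 := coeff_eq_zero_of_natDegree_lt (by omega)
        have hv0 : v.coeff (d + 1) = 0 := coeff_eq_zero_of_natDegree_lt (by omega)
        have hX (c : ZMod p) : (C c * X * (v - C (s j) * u)).coeff (d + 1) =
            c * (v - C (s j) * u).coeff d := by
          rw [mul_assoc, coeff_C_mul, coeff_X_mul]
        rw [coeff_sub, coeff_C_mul, coeff_add, coeff_add, hX, hX, hu0, hv0]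
        have : 0 + letterSign (ZMod p) δ * m * s j * (v - C (s j) * u).coeff d -
            s i * (0 + letterSign (ZMod p) δ * m * (v - C (s j) * u).coeff d) =
            letterSign (ZMod p) δ * m * (s j - s i) * (v - C (s j) * u).coeff d := by ring
        rw [this]
        exact mul_ne_zero (mul_ne_zero (mul_ne_zero (letterSign_ne_zero δ) hm0) hsij) hc
      · rw [hcons, transv_mul_apply_zero_one, transv_mul_apply_one_one, (he t).1, (he t).2]
        simp
        exact Or.inl (by ring)

theorem SL2.apply_zero_one_of_mem_center {K : Type*} [CommRing K]
    {g : Matrix.SpecialLinearGroup (Fin 2) K} (hg : g ∈ Subgroup.center _) : g 0 1 = 0 := by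
  obtain ⟨r, -, hr⟩ := Matrix.SpecialLinearGroup.mem_center_iff.1 hg
  rw [← hr]
  simp

theorem exists_injOn_zmod {p : ℕ} [NeZero p] {ι : Type*} (S : Finset ι) (hS : S.card ≤ p) :
    ∃ s : ι → ZMod p, Set.InjOn s S := by
  classical
  obtain ⟨e⟩ := Function.Embedding.nonempty_of_card_le (α := S) (β := ZMod p)
    (by simpa [ZMod.card] using hS)
  refine ⟨fun i => if h : i ∈ S then e ⟨i, h⟩ else 0, fun a ha b hb hab => ?_⟩
  rw [Finset.mem_coe] at ha hb
  simpa [ha, hb] using hab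

open Polynomial in
theorem le_wordLen_of_isLaw {p : ℕ} [Fact p.Prime] {k : ℕ} {w : FreeGroup (Fin k)} (hw : w ≠ 1)
    (hlaw : IsLaw (PSL2 p) w) : p ≤ wordLen w := by
  by_contra! hlt
  obtain ⟨⟨i, ε⟩, L, hL⟩ : ∃ x L, w.toWord = x :: L :=
    List.exists_cons_of_ne_nil (by simpa using hw)
  rw [wordLen, hL, List.length_cons] at hlt
  obtain ⟨s, hs⟩ := exists_injOn_zmod (p := p) (((i, ε) :: L).map Prod.fst).toFinset
    ((List.toFinset_card_le _).trans (by simp; omega))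
  obtain ⟨m, d, u, v, hm, hmd, hu, hv, hc, he⟩ := exists_transvEval_eq s L i ε
    (hL ▸ FreeGroup.isReduced_toWord) hlt (hs.mono fun x hx => by simpa using hx)
  have hm0 : (m : ZMod p) ≠ 0 := by
    rw [Ne, ZMod.natCast_eq_zero_iff]
    exact fun h => absurd (Nat.le_of_dvd hm h) (by omega)
  have hzero (t : ZMod p) : transvEval s t ((i, ε) :: L) 0 1 = 0 := by
    apply SL2.apply_zero_one_of_mem_center
    rw [← QuotientGroup.eq_one_iff, ← hlaw fun i => (transv (s i) t : PSL2 p)]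
    conv_rhs => rw [← FreeGroup.mk_toWord (x := w), hL, FreeGroup.lift_mk]
    change QuotientGroup.mk' _ _ = _
    rw [transvEval, map_list_prod, List.map_map]
    congr 2
    ext1 x
    rw [Function.comp_apply, ← cond_transv]
    cases x.2 <;> rfl
  have hdeg : (u + C (letterSign (ZMod p) ε * m) * X * (v - C (s i) * u)).natDegree ≤ d + 1 := by
    refine (natDegree_add_le_of_le (m := d) (n := d + 1) hu ?_).trans (by simp)
    rw [mul_assoc]
    refine (natDegree_C_mul_le _ _).trans (natDegree_mul_le.trans ?_)
    have := natDegree_X_le (R := ZMod p)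
    have : (v - C (s i) * u).natDegree ≤ d :=
      (natDegree_sub_le_of_le hv ((natDegree_C_mul_le _ _).trans hu)).trans (max_self d).le
    omega
  have h0 := eq_zero_of_natDegree_lt_card_of_eval_eq_zero
    (u + C (letterSign (ZMod p) ε * m) * X * (v - C (s i) * u)) (f := (id : ZMod p → ZMod p))
    Function.injective_id (fun t => by rw [id, ← (he t).1, hzero])
    (by rw [ZMod.card]; omega)
  have := congrArg (coeff · (d + 1)) h0
  simp only [coeff_add, coeff_zero, mul_assoc, coeff_C_mul, coeff_X_mul,
    coeff_eq_zero_of_natDegree_lt (Nat.lt_succ_of_le hu), zero_add] at this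
  rw [← mul_assoc] at this
  exact mul_ne_zero (mul_ne_zero (letterSign_ne_zero ε) hm0) hc (by simpa using this)

theorem isReduced_flatMap_replicate {ι : Type*} (S : List ((ι × Bool) × ℕ))
    (hS : S.IsChain fun x y => x.1.1 ≠ y.1.1) (hpos : ∀ x ∈ S, x.2 ≠ 0) :
    FreeGroup.IsReduced (S.flatMap fun x => List.replicate x.2 x.1) := by
  induction S with
  | nil => simp
  | cons x S ih =>
    rw [List.flatMap_cons, FreeGroup.IsReduced, List.isChain_append]
    refine ⟨List.isChain_replicate_of_rel _ fun _ => rfl,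
      ih hS.tail fun y hy => hpos y (List.mem_cons_of_mem _ hy), ?_⟩
    intro a ha b hb hab
    cases S with
    | nil => simp at hb
    | cons y S =>
      have hx := hpos x (by simp)
      have hy := hpos y (by simp)
      simp [List.getLast?_replicate, hx] at ha
      simp [List.head?_append, List.head?_replicate, hy] at hb
      subst ha hb
      exact absurd hab (List.isChain_cons_cons.1 hS).1

/-- The syllables of the word `[[x^a, y x^b y⁻¹], z x^c z⁻¹]`. -/
def commSyllables (a b c : ℕ) : List ((Fin 3 × Bool) × ℕ) :=
  [((0, true), a), ((1, true), 1), ((0, true), b), ((1, false), 1),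
   ((0, false), a), ((1, true), 1), ((0, false), b), ((1, false), 1),
   ((2, true), 1), ((0, true), c), ((2, false), 1),
   ((1, true), 1), ((0, true), b), ((1, false), 1), ((0, true), a),
   ((1, true), 1), ((0, false), b), ((1, false), 1), ((0, false), a),
   ((2, true), 1), ((0, false), c), ((2, false), 1)]

/-- The word `[[x^a, y x^b y⁻¹], z x^c z⁻¹]`. -/
def commWord (a b c : ℕ) : List (Fin 3 × Bool) :=
  (commSyllables a b c).flatMap fun x => List.replicate x.2 x.1

theorem length_commWord (a b c : ℕ) : (commWord a b c).length = 4 * a + 4 * b + 2 * c + 12 := by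
  simp [commWord, commSyllables]
  ring

theorem isReduced_commWord {a b c : ℕ} (ha : a ≠ 0) (hb : b ≠ 0) (hc : c ≠ 0) :
    FreeGroup.IsReduced (commWord a b c) :=
  isReduced_flatMap_replicate _ (by simp [commSyllables]) (by simp [commSyllables, ha, hb, hc])

theorem isLaw_commWord {Γ : Type*} [Group Γ] {a b c : ℕ}
    (h : ∀ g : Γ, g ^ a = 1 ∨ g ^ b = 1 ∨ g ^ c = 1) :
    IsLaw Γ (FreeGroup.mk (commWord a b c)) := by
  intro g
  rw [FreeGroup.lift_mk]
  rcases h (g 0) with h | h | h <;> simp [commWord, commSyllables, h]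

open Polynomial in
theorem SL2.exists_pow_eq_one_or_neg_one {p : ℕ} [Fact p.Prime] (hp : p ≠ 2) (g : SL2 p) :
    ∃ n ∈ ({(p - 1) / 2, (p + 1) / 2, p} : Set ℕ), g ^ n = 1 ∨ g ^ n = -1 := by
  have hodd : Odd p := (Fact.out : p.Prime).odd_of_ne_two hp
  let K := AlgebraicClosure (ZMod p)
  let f := algebraMap (ZMod p) K
  have hf : Function.Injective f := f.injective
  let M : Matrix (Fin 2) (Fin 2) K := (g : Matrix (Fin 2) (Fin 2) (ZMod p)).map f
  set τ : ZMod p := (g : Matrix (Fin 2) (Fin 2) (ZMod p)).trace with hτ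
  have hlift (n : ℕ) (h : M ^ n = 1 ∨ M ^ n = -1) : g ^ n = 1 ∨ g ^ n = -1 := by
    have hM : M ^ n = ((g ^ n : SL2 p) : Matrix (Fin 2) (Fin 2) (ZMod p)).map f := by
      rw [Matrix.SpecialLinearGroup.coe_pow]
      exact (map_pow f.mapMatrix _ n).symm
    refine h.imp (fun h => ?_) fun h => ?_
    · refine Subtype.ext (Matrix.map_injective hf ?_)
      change Matrix.map ((g ^ n : SL2 p) : Matrix (Fin 2) (Fin 2) (ZMod p)) f = Matrix.map _ f
      rw [← hM, h]
      exact (map_one f.mapMatrix).symm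
    · refine Subtype.ext (Matrix.map_injective hf ?_)
      change Matrix.map ((g ^ n : SL2 p) : Matrix (Fin 2) (Fin 2) (ZMod p)) f = Matrix.map _ f
      rw [← hM, h, Matrix.SpecialLinearGroup.coe_neg, Matrix.SpecialLinearGroup.coe_one]
      exact ((map_neg f.mapMatrix 1).trans (by rw [map_one])).symm
  obtain ⟨l, hl⟩ : ∃ l : K, l ^ 2 - f τ * l + 1 = 0 := by
    obtain ⟨l, hl⟩ := IsAlgClosed.exists_root (X ^ 2 - C (f τ) * X + 1 : K[X]) (by
      have : (X ^ 2 - C (f τ) * X + 1 : K[X]).degree = 2 := by compute_degree!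
      rw [this]; decide)
    exact ⟨l, by simpa using hl⟩
  have hdet : M.det = 1 := by
    have : M.det = f (g : Matrix (Fin 2) (Fin 2) (ZMod p)).det := (RingHom.map_det f _).symm
    rw [this, g.2, map_one]
  have htr : M.trace = f τ := by
    simp [M, hτ, Matrix.trace_fin_two]
  have hl0 : l ≠ 0 := by rintro rfl; simp at hl
  have hτl : f τ = l + l⁻¹ := by
    linear_combination -l⁻¹ * hl + (l - f τ) * mul_inv_cancel₀ hl0
  have hch : M.charpoly = (X - C l) * (X - C l⁻¹) := by
    rw [Matrix.charpoly_fin_two, hdet, htr, hτl]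
    have : C l * C l⁻¹ = (1 : K[X]) := by rw [← C_mul, mul_inv_cancel₀ hl0, C_1]
    simp only [C_add, C_1]
    linear_combination -this
  have hCH : (M - algebraMap K _ l) * (M - algebraMap K _ l⁻¹) = 0 := by
    have := Matrix.aeval_self_charpoly M
    rw [hch] at this
    simpa using this
  by_cases hll : l = l⁻¹
  · refine ⟨p, by simp, hlift p ?_⟩
    have hl1 : l = 1 ∨ l = -1 := mul_self_eq_one_iff.1 (by
      nth_rw 2 [hll]
      exact mul_inv_cancel₀ hl0)
    rw [← hll, ← pow_two] at hCH
    have hpow : (M - algebraMap K _ l) ^ p = 0 :=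
      pow_eq_zero_of_le (Fact.out : p.Prime).two_le hCH
    rw [sub_pow_char_of_commute _ (Algebra.commute_algebraMap_right l M), sub_eq_zero] at hpow
    rw [hpow]
    rcases hl1 with rfl | rfl
    · simp
    · simp [hodd.neg_one_pow]
  · have hlp : l ^ p = l ∨ l ^ p = l⁻¹ := by
      have h1 : (l ^ p) ^ 2 - f τ * l ^ p + 1 = 0 := by
        have := congrArg (frobenius K p) hl
        simp only [map_add, map_sub, map_mul, map_one, map_zero, map_pow] at this
        rw [frobenius_def, frobenius_def, ← map_pow, ZMod.pow_card] at this
        exact this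
      have h2 : (l ^ p - l) * (l ^ p - l⁻¹) = 0 := by
        rw [hτl] at h1
        linear_combination h1 + mul_inv_cancel₀ hl0
      exact (mul_eq_zero.1 h2).imp sub_eq_zero.1 sub_eq_zero.1
    have key (n : ℕ) (h : l ^ (2 * n) = 1) : M ^ n = 1 ∨ M ^ n = -1 := by
      rw [two_mul, pow_add, mul_self_eq_one_iff] at h
      have hinv : l⁻¹ ^ n = l ^ n := by
        rw [inv_pow]
        rcases h with h | h <;> simp [h]
      have hdvd : (X - C l) * (X - C l⁻¹) ∣ X ^ n - C (l ^ n) :=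
        (isCoprime_X_sub_C_of_isUnit_sub (sub_ne_zero.2 hll).isUnit).mul_dvd
          (dvd_iff_isRoot.2 (by simp)) (dvd_iff_isRoot.2 (by simp [hinv]))
      obtain ⟨q, hq⟩ := hdvd
      have hM : M ^ n = algebraMap K _ (l ^ n) := by
        have := congrArg (aeval M) hq
        rw [← hch, map_mul, Matrix.aeval_self_charpoly, zero_mul] at this
        simpa [sub_eq_zero] using this
      rw [hM]
      exact h.imp (fun h => by simp [h]) fun h => by simp [h]
    obtain ⟨r, hr⟩ := hodd
    rcases hlp with h | h
    · refine ⟨(p - 1) / 2, by simp, hlift _ (key _ ?_)⟩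
      have : 2 * ((p - 1) / 2) + 1 = p := by omega
      exact mul_right_cancel₀ hl0 (by rw [← pow_succ, this, h, one_mul])
    · refine ⟨(p + 1) / 2, by simp, hlift _ (key _ ?_)⟩
      have : 2 * ((p + 1) / 2) = p + 1 := by omega
      rw [this, pow_succ, h, inv_mul_cancel₀ hl0]

theorem PSL2.pow_eq_one {p : ℕ} [Fact p.Prime] (hp : p ≠ 2) (g : PSL2 p) :
    g ^ ((p - 1) / 2) = 1 ∨ g ^ ((p + 1) / 2) = 1 ∨ g ^ p = 1 := by
  obtain ⟨g, rfl⟩ := QuotientGroup.mk_surjective g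
  obtain ⟨n, hn, h⟩ := SL2.exists_pow_eq_one_or_neg_one hp g
  have hg : (g : PSL2 p) ^ n = 1 := by
    rw [← QuotientGroup.mk_pow, QuotientGroup.eq_one_iff, Subgroup.mem_center_iff]
    intro x
    rcases h with h | h <;> simp [h]
  rcases hn with rfl | rfl | rfl
  · exact Or.inl hg
  · exact Or.inr (Or.inl hg)
  · exact Or.inr (Or.inr hg)

theorem PSL2.pow_six_eq_one (g : PSL2 2) : g ^ 6 = 1 := by
  obtain ⟨g, rfl⟩ := QuotientGroup.mk_surjective g
  have h : ∀ g : SL2 2, g ^ 6 = 1 := by decide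
  rw [← QuotientGroup.mk_pow, h, QuotientGroup.mk_one]

theorem exists_law_PSL2 (p : ℕ) [Fact p.Prime] : ∃ (k : ℕ) (w : FreeGroup (Fin k)),
    1 ≤ k ∧ w ≠ 1 ∧ IsLaw (PSL2 p) w ∧ wordLen w ≤ 8 * p + 6 := by
  have h2 := (Fact.out : p.Prime).two_le
  by_cases hp : p = 2
  · subst hp
    refine ⟨1, FreeGroup.of 0 ^ 6, le_rfl, ?_, fun g => ?_, ?_⟩
    · simp [← FreeGroup.toWord_eq_nil_iff]
    · rw [map_pow, PSL2.pow_six_eq_one]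
    · simp [wordLen, FreeGroup.toWord_of_pow]
  · have hw : (FreeGroup.mk (commWord ((p - 1) / 2) ((p + 1) / 2) p)).toWord = _ :=
      FreeGroup.toWord_mk.trans
        (isReduced_commWord (by omega) (by omega) (by omega)).reduce_eq
    refine ⟨3, _, by simp, fun h => ?_, isLaw_commWord (PSL2.pow_eq_one hp), ?_⟩
    · rw [h] at hw
      simpa [length_commWord] using congrArg List.length hw
    · rw [wordLen, hw, length_commWord]
      obtain ⟨r, hr⟩ := (Fact.out : p.Prime).odd_of_ne_two hp
      omega

/-- For a prime `p`, `(p − 1)/3 ≤ α(PSL₂(p)) ≤ 8p + 6`. -/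
theorem stmt9 (p : ℕ) (hp : p.Prime) :
    p - 1 ≤ 3 * alphaLaw (PSL2 p) ∧ alphaLaw (PSL2 p) ≤ 8 * p + 6 := by
  have := Fact.mk hp
  obtain ⟨k, w, hk, hw, hlaw, hlen⟩ := exists_law_PSL2 p
  have hmem : wordLen w ∈ {n | ∃ (k : ℕ) (w : FreeGroup (Fin k)),
      1 ≤ k ∧ w ≠ 1 ∧ IsLaw (PSL2 p) w ∧ wordLen w = n} := ⟨k, w, hk, hw, hlaw, rfl⟩
  refine ⟨?_, (Nat.sInf_le hmem).trans hlen⟩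
  obtain ⟨k', w', -, hw', hlaw', hlen'⟩ := Nat.sInf_mem ⟨_, hmem⟩
  have := le_wordLen_of_isLaw hw' hlaw'
  rw [alphaLaw, ← hlen']
  omega
end

section
/- Let p be a prime. Then every element g of PSL_2(p) has order dividing p − 1, p, or p + 1; equivalently, g^{p−1} = e or g^p = e or g^{p+1} = e. -/
open Matrix

/-- In dimension two, a matrix of determinant one with eigenvalue `1` is unipotent. -/
theorem sub_one_sq_eq_zero_of_det {R : Type*} [CommRing R] {M : Matrix (Fin 2) (Fin 2) R}
    (hM : M.det = 1) (h : (M - 1).det = 0) : (M - 1) ^ 2 = 0 := by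
  rw [det_fin_two] at hM h
  simp only [Matrix.sub_apply, one_apply_eq, one_apply_ne (zero_ne_one (α := Fin 2)),
    one_apply_ne (one_ne_zero (α := Fin 2)), sub_zero] at h
  have ht : M 0 0 + M 1 1 = 2 := by linear_combination hM - h
  ext i j
  fin_cases i <;> fin_cases j <;>
    simp [pow_two, mul_apply, Fin.sum_univ_two]
  · linear_combination (M 0 0) * ht - hM
  · linear_combination (M 0 1) * ht
  · linear_combination (M 1 0) * ht
  · linear_combination (M 1 1) * ht - hM

namespace Matrix.SpecialLinearGroup

variable {p : ℕ} [Fact p.Prime]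

theorem pow_prime_eq_one_of_det {A : SpecialLinearGroup (Fin 2) (ZMod p)}
    (h : ((A : Matrix (Fin 2) (Fin 2) (ZMod p)) - 1).det = 0) : A ^ p = 1 := by
  have hp : p.Prime := Fact.out
  apply Subtype.ext
  have h0 : ((A : Matrix (Fin 2) (Fin 2) (ZMod p)) - 1) ^ p = 0 :=
    pow_eq_zero_of_le hp.two_le (sub_one_sq_eq_zero_of_det A.2 h)
  rw [sub_pow_char_of_commute p (Commute.one_right _), one_pow, sub_eq_zero] at h0
  simpa using h0

theorem coe_add_coe_inv (A : SpecialLinearGroup (Fin 2) (ZMod p)) :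
    (A : Matrix (Fin 2) (Fin 2) (ZMod p)) + (A⁻¹ : SpecialLinearGroup (Fin 2) (ZMod p)) = scalar (Fin 2) (A.1.trace) := by
  rw [SpecialLinearGroup.coe_inv, adjugate_fin_two, trace_fin_two]
  ext i j
  fin_cases i <;> fin_cases j <;> simp [add_comm]

/-- The Frobenius fixes the trace, so `A ^ p` is a root of the characteristic polynomial
of `A`. -/
theorem pow_sub_one_mul_pow_add_one (A : SpecialLinearGroup (Fin 2) (ZMod p)) :
    (((A ^ (p - 1) : SpecialLinearGroup (Fin 2) (ZMod p)) : Matrix (Fin 2) (Fin 2) (ZMod p)) - 1) *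
      (((A ^ (p + 1) : SpecialLinearGroup (Fin 2) (ZMod p)) : Matrix (Fin 2) (Fin 2) (ZMod p)) - 1) = 0 := by
  have hp : p.Prime := Fact.out
  have hc : Commute (A : Matrix (Fin 2) (Fin 2) (ZMod p)) (A⁻¹ : SpecialLinearGroup (Fin 2) (ZMod p)) := by
    simp only [Commute, SemiconjBy, ← SpecialLinearGroup.coe_mul, mul_inv_cancel, inv_mul_cancel]
  have h : ((A ^ p : SpecialLinearGroup (Fin 2) (ZMod p)) : Matrix (Fin 2) (Fin 2) (ZMod p)) + (A⁻¹ ^ p : SpecialLinearGroup (Fin 2) (ZMod p)) =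
      A + (A⁻¹ : SpecialLinearGroup (Fin 2) (ZMod p)) := by
    rw [SpecialLinearGroup.coe_pow, SpecialLinearGroup.coe_pow,
      ← add_pow_char_of_commute p hc, coe_add_coe_inv, ← map_pow, ZMod.pow_card]
  have h2 := congrArg (fun M => ((A ^ p : SpecialLinearGroup (Fin 2) (ZMod p)) : Matrix (Fin 2) (Fin 2) (ZMod p)) * M) h
  simp only [mul_add, ← SpecialLinearGroup.coe_mul] at h2
  have e1 : A ^ p * A⁻¹ ^ p = 1 := by simp
  have e2 : A ^ p * A = A ^ (p + 1) := (pow_succ A p).symm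
  have e3 : A ^ p * A⁻¹ = A ^ (p - 1) := (pow_sub_one_mul hp.ne_zero A) ▸ by group
  have e4 : A ^ (p - 1) * A ^ (p + 1) = A ^ p * A ^ p := by
    rw [← pow_add, ← pow_add]; congr 1; have := hp.two_le; omega
  rw [e1, e2, e3] at h2
  rw [sub_mul, mul_sub, ← SpecialLinearGroup.coe_mul, e4]
  simp only [mul_one, one_mul, SpecialLinearGroup.coe_one] at h2 ⊢
  rw [sub_sub, ← sub_eq_zero.mpr h2]
  abel

theorem mem_center_of_sq_eq_one (hp2 : p ≠ 2) {A : SpecialLinearGroup (Fin 2) (ZMod p)} (h : A ^ 2 = 1) :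
    A ∈ Subgroup.center (SpecialLinearGroup (Fin 2) (ZMod p)) := by
  have hchar : ringChar (ZMod p) ≠ 2 := by rwa [ZMod.ringChar_zmod_n]
  have hinv : A⁻¹ = A := inv_eq_of_mul_eq_one_left (by rw [← pow_two, h])
  have hadj := congrArg (fun B : SpecialLinearGroup (Fin 2) (ZMod p) => (B : Matrix (Fin 2) (Fin 2) (ZMod p))) hinv
  simp only [SpecialLinearGroup.coe_inv, adjugate_fin_two] at hadj
  have h00 : A 1 1 = A 0 0 := by simpa using congrFun (congrFun hadj 0) 0
  have h01 : A 0 1 = 0 :=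
    (Ring.eq_self_iff_eq_zero_of_char_ne_two hchar).mp
      (by simpa using congrFun (congrFun hadj 0) 1)
  have h10 : A 1 0 = 0 :=
    (Ring.eq_self_iff_eq_zero_of_char_ne_two hchar).mp
      (by simpa using congrFun (congrFun hadj 1) 0)
  have hdet := A.2
  rw [det_fin_two] at hdet
  rw [SpecialLinearGroup.mem_center_iff]
  refine ⟨A 0 0, ?_, ?_⟩
  · simp only [Fintype.card_fin]
    linear_combination hdet - A 0 0 * h00 + A 1 0 * h01
  · ext i j
    fin_cases i <;> fin_cases j <;> simp [h00, h01, h10]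

theorem pow_mem_center (A : SpecialLinearGroup (Fin 2) (ZMod p)) :
    A ^ (p - 1) = 1 ∨ A ^ p ∈ Subgroup.center (SpecialLinearGroup (Fin 2) (ZMod p)) ∨ A ^ (p + 1) = 1 := by
  have hp : p.Prime := Fact.out
  have hmul := pow_sub_one_mul_pow_add_one A
  by_cases hX : (((A ^ (p - 1) : SpecialLinearGroup (Fin 2) (ZMod p)) : Matrix (Fin 2) (Fin 2) (ZMod p)) - 1).det = 0
  swap
  · have hu := (isUnit_iff_isUnit_det _).mpr (isUnit_iff_ne_zero.mpr hX)
    exact .inr <| .inr <| Subtype.ext <| sub_eq_zero.mp <| hu.mul_right_eq_zero.mp hmul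
  by_cases hY : (((A ^ (p + 1) : SpecialLinearGroup (Fin 2) (ZMod p)) : Matrix (Fin 2) (Fin 2) (ZMod p)) - 1).det = 0
  swap
  · have hu := (isUnit_iff_isUnit_det _).mpr (isUnit_iff_ne_zero.mpr hY)
    exact .inl <| Subtype.ext <| sub_eq_zero.mp <| hu.mul_left_eq_zero.mp hmul
  refine .inr (.inl ?_)
  have hX1 := pow_prime_eq_one_of_det hX
  have hY1 := pow_prime_eq_one_of_det hY
  obtain rfl | hp2 := eq_or_ne p 2
  · have h1 : A ^ 2 = 1 := by simpa using hX1
    rw [h1]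
    exact one_mem _
  · apply mem_center_of_sq_eq_one hp2
    have e : A ^ (p + 1) = A ^ (p - 1) * A ^ 2 := by
      rw [← pow_add]; congr 1; have := hp.two_le; omega
    rwa [e, ((Commute.refl A).pow_pow _ _).mul_pow, hX1, one_mul, ← pow_mul, mul_comm,
      pow_mul] at hY1

end Matrix.SpecialLinearGroup

/-- For a prime `p`, every element `g` of `PSL₂(p)` has order dividing
`p − 1`, `p`, or `p + 1`; equivalently, `g^(p−1) = e` or `g^p = e` or `g^(p+1) = e`. -/
theorem stmt10 (p : ℕ) (hp : p.Prime) (g : PSL2 p) :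
    (orderOf g ∣ p - 1 ∨ orderOf g ∣ p ∨ orderOf g ∣ p + 1) ∧
    (g ^ (p - 1) = 1 ∨ g ^ p = 1 ∨ g ^ (p + 1) = 1) := by
  have : Fact p.Prime := ⟨hp⟩
  simp only [orderOf_dvd_iff_pow_eq_one, and_self]
  obtain ⟨A, rfl⟩ := QuotientGroup.mk_surjective g
  simp only [← QuotientGroup.mk_pow, QuotientGroup.eq_one_iff]
  rcases SpecialLinearGroup.pow_mem_center A with h | h | h
  · exact .inl (h ▸ one_mem _)
  · exact .inr (.inl h)
  · exact .inr (.inr (h ▸ one_mem _))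
end

section
/- Let L : ℕ → ℕ be a nondecreasing unbounded function, for each n let p_n be the smallest prime with L(n) < (p_n − 1)/3, and let W_n := { w ∈ F_2 : w ≠ 1, |w| < (p_n − 1)/3 }. Then for every n ∈ ℕ there exists a nontrivial law w̄_n ∈ F_2 for the group ⊕_{i=1}^n PSL_2(p_i)^{W_i} with |w̄_n| < n²·(768·L(n) + 352). -/
/-- `W_n = {w ∈ F₂ : w ≠ 1, |w| < (P n − 1)/3}` (for naturals, `|w| < (P n − 1)/3` is
equivalent to `3|w| + 1 < P n`). -/
abbrev Wset (P : ℕ → ℕ) (n : ℕ) : Type :=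
  {w : FreeGroup (Fin 2) // w ≠ 1 ∧ 3 * wordLen w + 1 < P n}

/-- The direct sum `⊕_{i=1}^n PSL₂(P i)^{W_i}` (a finite direct product). -/
abbrev SumGrp (P : ℕ → ℕ) (n : ℕ) : Type :=
  ∀ i : Fin n, Wset P (i.1 + 1) → PSL2 (P (i.1 + 1))

/-- The conjugate by the first generator of the commutator of `u` with the conjugate of `v` by the
second generator. -/
def twistedComm (u v : FreeGroup (Fin 2)) : FreeGroup (Fin 2) :=
  FreeGroup.of 0 * (u * (FreeGroup.of 1 * v * (FreeGroup.of 1)⁻¹) * u⁻¹ *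
    (FreeGroup.of 1 * v * (FreeGroup.of 1)⁻¹)⁻¹) * (FreeGroup.of 0)⁻¹

/-- The reduced word of `w` starts with the first generator, and ends with it or its inverse. -/
def Anchored (w : FreeGroup (Fin 2)) : Prop :=
  w.toWord.head? = some (0, true) ∧ ∃ b, w.toWord.getLast? = some (0, b)

theorem Anchored.ne_one {w : FreeGroup (Fin 2)} (h : Anchored w) : w ≠ 1 := by
  rintro rfl
  simp [Anchored] at h

theorem head?_invRev {α : Type*} (l : List (α × Bool)) :
    (FreeGroup.invRev l).head? = l.getLast?.map fun a => (a.1, !a.2) := by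
  simp [FreeGroup.invRev]

theorem getLast?_invRev {α : Type*} (l : List (α × Bool)) :
    (FreeGroup.invRev l).getLast? = l.head?.map fun a => (a.1, !a.2) := by
  simp [FreeGroup.invRev]

theorem toWord_twistedComm {u v : FreeGroup (Fin 2)} (hu : Anchored u) (hv : Anchored v) :
    (twistedComm u v).toWord = [(0, true)] ++ (u.toWord ++ ([(1, true)] ++ (v.toWord ++
      ([(1, false)] ++ (u⁻¹.toWord ++ ([(1, true)] ++ (v⁻¹.toWord ++
        [(1, false), (0, false)]))))))) := by
  obtain ⟨hu1, b, hu2⟩ := hu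
  obtain ⟨hv1, c, hv2⟩ := hv
  have hmk : twistedComm u v = FreeGroup.mk ([(0, true)] ++ (u.toWord ++ ([(1, true)] ++
      (v.toWord ++ ([(1, false)] ++ (u⁻¹.toWord ++ ([(1, true)] ++ (v⁻¹.toWord ++
        [(1, false), (0, false)])))))))) := by
    have hy : (FreeGroup.mk [((1 : Fin 2), false), (0, false)]) =
        (FreeGroup.of 1)⁻¹ * (FreeGroup.of 0)⁻¹ := rfl
    have hY : (FreeGroup.mk [((1 : Fin 2), false)]) = (FreeGroup.of 1)⁻¹ := rfl
    simp only [← FreeGroup.mul_mk, FreeGroup.mk_toWord, hy, hY]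
    simp only [twistedComm, FreeGroup.of]
    group
  rw [hmk, FreeGroup.toWord_mk]
  apply FreeGroup.IsReduced.reduce_eq
  have hru : FreeGroup.IsReduced u.toWord := FreeGroup.isReduced_toWord
  have hrv : FreeGroup.IsReduced v.toWord := FreeGroup.isReduced_toWord
  have hru' : FreeGroup.IsReduced u⁻¹.toWord := FreeGroup.isReduced_toWord
  have hrv' : FreeGroup.IsReduced v⁻¹.toWord := FreeGroup.isReduced_toWord
  rw [FreeGroup.toWord_inv] at hru' hrv' ⊢
  rw [FreeGroup.toWord_inv]
  unfold FreeGroup.IsReduced at *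
  simp only [List.isChain_append, hru, hrv, hru', hrv', List.head?_append, getLast?_invRev,
    head?_invRev, hu1, hu2, hv1, hv2]
  simp

theorem Anchored.twistedComm {u v : FreeGroup (Fin 2)} (hu : Anchored u) (hv : Anchored v) :
    Anchored (twistedComm u v) := by
  unfold Anchored
  rw [toWord_twistedComm hu hv]
  simp [List.getLast?_append, List.getLast?_cons]

theorem wordLen_twistedComm {u v : FreeGroup (Fin 2)} (hu : Anchored u) (hv : Anchored v) :
    wordLen (twistedComm u v) = 2 * wordLen u + 2 * wordLen v + 6 := by
  unfold wordLen
  rw [toWord_twistedComm hu hv]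
  simp only [FreeGroup.toWord_inv, List.length_append, FreeGroup.invRev_length, List.length_cons,
    List.length_nil]
  ring

/-- The iterated twisted commutator of the powers `x ^ a 0, …, x ^ a (2 ^ k - 1)`. -/
def powerTree : (k : ℕ) → (ℕ → ℕ) → FreeGroup (Fin 2)
  | 0, a => FreeGroup.of 0 ^ a 0
  | k + 1, a => twistedComm (powerTree k a) (powerTree k fun j => a (j + 2 ^ k))

theorem anchored_powerTree (k : ℕ) (a : ℕ → ℕ) (ha : ∀ j, a j ≠ 0) : Anchored (powerTree k a) := by
  induction k generalizing a with
  | zero =>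
    unfold Anchored powerTree
    rw [FreeGroup.toWord_of_pow]
    simp [List.head?_replicate, List.getLast?_replicate, ha 0]
  | succ k ih => exact (ih a ha).twistedComm (ih _ fun j => ha _)

theorem wordLen_powerTree_le (k : ℕ) (a : ℕ → ℕ) (ha : ∀ j, a j ≠ 0) (A : ℕ) (hA : ∀ j, a j ≤ A) :
    wordLen (powerTree k a) + 2 ≤ 4 ^ k * (A + 2) := by
  induction k generalizing a with
  | zero => simpa [powerTree, wordLen] using hA 0
  | succ k ih =>
    have h := wordLen_twistedComm (anchored_powerTree k a ha)
      (anchored_powerTree k (fun j => a (j + 2 ^ k)) fun j => ha _)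
    have h1 := ih a ha hA
    have h2 := ih (fun j => a (j + 2 ^ k)) (fun j => ha _) fun j => hA _
    rw [powerTree, h, pow_succ]
    linarith

theorem lift_twistedComm_eq_one {G : Type*} [Group G] (g : Fin 2 → G) {u v : FreeGroup (Fin 2)}
    (h : FreeGroup.lift g u = 1 ∨ FreeGroup.lift g v = 1) :
    FreeGroup.lift g (twistedComm u v) = 1 := by
  rcases h with h | h <;> simp [twistedComm, h]

theorem lift_powerTree_eq_one {G : Type*} [Group G] (g : Fin 2 → G) (k : ℕ) (a : ℕ → ℕ) (j : ℕ)
    (hj : j < 2 ^ k) (h : g 0 ^ a j = 1) : FreeGroup.lift g (powerTree k a) = 1 := by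
  induction k generalizing a j with
  | zero =>
    obtain rfl : j = 0 := by simpa using hj
    simpa [powerTree] using h
  | succ k ih =>
    apply lift_twistedComm_eq_one
    by_cases hjk : j < 2 ^ k
    · exact Or.inl (ih a j hjk h)
    · refine Or.inr (ih _ (j - 2 ^ k) (by rw [pow_succ] at hj; omega) ?_)
      rwa [Nat.sub_add_cancel (by omega)]

theorem exists_pow_eq_smul_add_smul {R : Type*} [CommRing R] {g : Matrix (Fin 2) (Fin 2) R} {t : R}
    (hg : g * g = t • g - 1) (n : ℕ) : ∃ a b : R, g ^ n = a • g + b • 1 := by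
  induction n with
  | zero => exact ⟨0, 1, by simp⟩
  | succ n ih =>
    obtain ⟨a, b, h⟩ := ih
    refine ⟨a * t + b, -a, ?_⟩
    rw [pow_succ, h, add_mul, smul_mul_assoc, hg, smul_mul_assoc, one_mul]
    module

theorem mem_center_of_coe_eq_smul {R : Type*} [CommRing R]
    {g : Matrix.SpecialLinearGroup (Fin 2) R} {c : R}
    (h : (g : Matrix (Fin 2) (Fin 2) R) = c • 1) :
    g ∈ Subgroup.center (Matrix.SpecialLinearGroup (Fin 2) R) := by
  rw [Subgroup.mem_center_iff]
  intro x
  apply Subtype.ext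
  simp [Matrix.SpecialLinearGroup.coe_mul, h]

theorem mul_self_eq_trace_smul_sub_one {R : Type*} [CommRing R]
    (g : Matrix.SpecialLinearGroup (Fin 2) R) :
    (g : Matrix (Fin 2) (Fin 2) R) * g = (g : Matrix (Fin 2) (Fin 2) R).trace • g.1 - 1 := by
  have hd := g.det_coe
  rw [Matrix.det_fin_two] at hd
  ext i j
  fin_cases i <;> fin_cases j <;>
    simp [Matrix.mul_apply, Matrix.trace_fin_two, Fin.sum_univ_two] <;> grind

theorem pow_pred_eq_one_of_pow_eq {G : Type*} [Group G] {g : G} {p : ℕ} (hp : 0 < p)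
    (h : g ^ p = g) : g ^ (p - 1) = 1 := by
  obtain ⟨q, rfl⟩ : ∃ q, p = q + 1 := ⟨p - 1, by omega⟩
  simpa [pow_succ] using h

theorem pow_mem_center_SL2 (p : ℕ) (hp : p.Prime) (g : SL2 p) :
    ∃ i < 3, g ^ (p - 1 + i) ∈ Subgroup.center (SL2 p) := by
  have : Fact p.Prime := ⟨hp⟩
  have hp0 := hp.pos
  have hcentral (c : ZMod p) (h : g.1 ^ p = c • 1) :
      ∃ i < 3, g ^ (p - 1 + i) ∈ Subgroup.center (SL2 p) :=
    ⟨1, by norm_num, mem_center_of_coe_eq_smul (c := c) (by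
      rw [Nat.sub_add_cancel hp0, Matrix.SpecialLinearGroup.coe_pow]; exact h)⟩
  have hsplit (h : g.1 ^ p = g.1) : ∃ i < 3, g ^ (p - 1 + i) ∈ Subgroup.center (SL2 p) := by
    refine ⟨0, by norm_num, ?_⟩
    have : g ^ p = g := Subtype.ext (by rw [Matrix.SpecialLinearGroup.coe_pow]; exact h)
    rw [add_zero, pow_pred_eq_one_of_pow_eq hp0 this]
    exact one_mem _
  have hg := mul_self_eq_trace_smul_sub_one g
  have hinert (h : g.1 ^ p = g.1.trace • 1 - g.1) :
      ∃ i < 3, g ^ (p - 1 + i) ∈ Subgroup.center (SL2 p) := by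
    refine ⟨2, by norm_num, ?_⟩
    have : g ^ (p + 1) = 1 := Subtype.ext (by
      rw [Matrix.SpecialLinearGroup.coe_pow, pow_succ, h, sub_mul, hg]; simp)
    rw [show p - 1 + 2 = p + 1 by omega, this]
    exact one_mem _
  set t := g.1.trace with ht
  obtain ⟨a, b, hab⟩ := exists_pow_eq_smul_add_smul hg p
  have htr : a * t + b * 2 = t := by
    have := ZMod.trace_pow_card g.1
    rw [ZMod.pow_card, hab] at this
    simpa [Matrix.trace_add, Matrix.trace_smul, ← ht] using this
  have hdet : a ^ 2 + a * b * t + b ^ 2 = 1 := by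
    have h : (a • g.1 + b • 1).det = 1 := by rw [← hab, Matrix.det_pow, g.2, one_pow]
    have hd := g.2
    rw [Matrix.det_fin_two] at h hd
    rw [ht, Matrix.trace_fin_two]
    simp at h
    linear_combination h - a ^ 2 * hd
  have hfac : (1 - a ^ 2) * (4 - t ^ 2) = 0 := by
    linear_combination (-4) * hdet + (a * t + 2 * b + t) * htr
  have hscalar (ε : ZMod p) (h1 : ε * ε = 1) (h2 : t = 2 * ε) :
      ∃ i < 3, g ^ (p - 1 + i) ∈ Subgroup.center (SL2 p) := by
    have hsq : (g.1 - ε • 1) ^ 2 = 0 := by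
      rw [pow_two, sub_mul, mul_sub, mul_sub, hg, h2]
      simp only [smul_mul_assoc, mul_smul_comm, one_mul, mul_one, smul_smul, h1]
      module
    have hpow : (g.1 - ε • 1) ^ p = 0 := pow_eq_zero_of_le hp.two_le hsq
    rw [sub_pow_char_of_commute p ((Commute.one_right _).smul_right _), smul_pow, one_pow] at hpow
    exact hcentral (ε ^ p) (sub_eq_zero.mp hpow)
  rcases mul_eq_zero.mp hfac with h | h
  · have h' : (a - 1) * (a + 1) = 0 := by linear_combination -h
    by_cases h2 : (2 : ZMod p) = 0
    · have ha : a = 1 := by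
        rcases mul_eq_zero.mp h' with h | h
        · linear_combination h
        · linear_combination h - h2
      subst ha
      have hb : b * (t + b) = 0 := by linear_combination hdet
      rcases mul_eq_zero.mp hb with hb | hb
      · exact hsplit (by rw [hab, hb]; simp)
      · apply hinert
        have ha : (1 : ZMod p) = -1 := by linear_combination h2
        have hb' : b = t := by linear_combination hb - t * h2
        rw [hab, hb']
        nth_rewrite 1 [ha]
        module
    · rcases mul_eq_zero.mp h' with h | h
      · have ha : a = 1 := by linear_combination h
        have hb : b = 0 := by
          apply (mul_eq_zero.mp (show b * 2 = 0 by linear_combination htr - t * h)).resolve_right h2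
        exact hsplit (by rw [hab, ha, hb]; simp)
      · have ha : a = -1 := by linear_combination h
        have hb : b = t := by
          have : (b - t) * 2 = 0 := by linear_combination htr - t * h
          linear_combination (mul_eq_zero.mp this).resolve_right h2
        exact hinert (by rw [hab, ha, hb]; module)
  · by_cases h2 : (2 : ZMod p) = 0
    · have ht0 : t = 0 := by
        have : t ^ 2 = 0 := by linear_combination 2 * h2 - h
        exact pow_eq_zero_iff two_ne_zero |>.mp this
      exact hscalar 1 (by ring) (by rw [ht0]; linear_combination -h2)
    · refine hscalar (t / 2) ?_ ?_
      · field_simp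
        linear_combination -h
      · field_simp

theorem exists_pow_eq_one_PSL2 (p : ℕ) (hp : p.Prime) (g : PSL2 p) :
    ∃ i < 3, g ^ (p - 1 + i) = 1 := by
  obtain ⟨g, rfl⟩ := QuotientGroup.mk_surjective g
  obtain ⟨i, hi, h⟩ := pow_mem_center_SL2 p hp g
  exact ⟨i, hi, by rwa [← QuotientGroup.mk_pow, QuotientGroup.eq_one_iff]⟩

/-- With `P n` the smallest prime where `L n < (P n − 1)/3`, for every
`n ≥ 1` there is a nontrivial law `w̄_n ∈ F₂` for `⊕_{i=1}^n PSL₂(P i)^{W_i}` of length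
less than `n²(768·L(n) + 352)`. -/
theorem stmt12 (L : ℕ → ℕ)
    (hLmono : ∀ ⦃m n : ℕ⦄, 1 ≤ m → m ≤ n → L m ≤ L n)
    (hLunb : ∀ N : ℕ, ∃ n : ℕ, 1 ≤ n ∧ N ≤ L n)
    (P : ℕ → ℕ)
    (hP : ∀ n : ℕ, 1 ≤ n → (P n).Prime ∧ 3 * L n + 1 < P n ∧
      ∀ r : ℕ, r.Prime → 3 * L n + 1 < r → P n ≤ r) :
    ∀ n : ℕ, 1 ≤ n → ∃ w : FreeGroup (Fin 2),
      w ≠ 1 ∧ IsLaw (SumGrp P n) w ∧ wordLen w < n ^ 2 * (768 * L n + 352) := by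
  intro n hn
  have hPle (m : ℕ) (hm : 1 ≤ m) (hmn : m ≤ n) : P m ≤ 6 * L n + 2 := by
    obtain ⟨r, hr, hlt, hle⟩ := Nat.exists_prime_lt_and_le_two_mul (3 * L m + 1) (by omega)
    have h1 := (hP m hm).2.2 r hr hlt
    have h2 := hLmono hm hmn
    omega
  set a : ℕ → ℕ := fun j => if j < 3 * n then P (j / 3 + 1) - 1 + j % 3 else 1 with ha
  have ha0 (j : ℕ) : a j ≠ 0 := by
    simp only [ha]
    split_ifs
    · have := (hP (j / 3 + 1) (by omega)).1.two_le
      omega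
    · norm_num
  have haA (j : ℕ) : a j ≤ 6 * L n + 3 := by
    simp only [ha]
    split_ifs
    · have := hPle (j / 3 + 1) (by omega) (by omega)
      omega
    · omega
  set k := Nat.clog 2 (3 * n) with hk
  have hk1 : 3 * n ≤ 2 ^ k := Nat.le_pow_clog (by norm_num) _
  have hk2 : 2 ^ k < 6 * n := by
    have h : 2 ^ (k - 1) < 3 * n := Nat.pow_pred_clog_lt_self (by norm_num) (by omega)
    have h0 : 0 < k := Nat.clog_pos (by norm_num) (by omega)
    have h1 : 2 ^ (k - 1) * 2 = 2 ^ k := pow_sub_one_mul h0.ne' 2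
    omega
  refine ⟨powerTree k a, (anchored_powerTree k a ha0).ne_one, fun g => ?_, ?_⟩
  · funext i s
    have hi := i.2
    let φ : SumGrp P n →* PSL2 (P (i.1 + 1)) :=
      (Pi.evalMonoidHom (fun _ => PSL2 (P (i.1 + 1))) s).comp
        (Pi.evalMonoidHom (fun i : Fin n => Wset P (i.1 + 1) → PSL2 (P (i.1 + 1))) i)
    have hφ : φ.comp (FreeGroup.lift g) = FreeGroup.lift (φ ∘ g) := by
      ext; simp
    change (φ.comp (FreeGroup.lift g)) (powerTree k a) = 1
    rw [hφ]
    obtain ⟨r, hr, h⟩ := exists_pow_eq_one_PSL2 _ (hP (i.1 + 1) (by omega)).1 ((φ ∘ g) 0)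
    refine lift_powerTree_eq_one _ k a (3 * i.1 + r) (by omega) ?_
    have : a (3 * i.1 + r) = P (i.1 + 1) - 1 + r := by
      simp only [ha]
      rw [if_pos (by omega), show (3 * i.1 + r) / 3 = i.1 by omega,
        show (3 * i.1 + r) % 3 = r by omega]
    rw [this, h]
  · have h := wordLen_powerTree_le k a ha0 _ haA
    have h4 : 4 ^ k ≤ 36 * n ^ 2 := by
      calc 4 ^ k = (2 ^ k) ^ 2 := by rw [← pow_mul, mul_comm, pow_mul]; norm_num
        _ ≤ (6 * n) ^ 2 := Nat.pow_le_pow_left hk2.le 2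
        _ = 36 * n ^ 2 := by ring
    calc wordLen (powerTree k a) < wordLen (powerTree k a) + 2 := by omega
      _ ≤ 4 ^ k * (6 * L n + 3 + 2) := h
      _ ≤ 36 * n ^ 2 * (6 * L n + 3 + 2) := Nat.mul_le_mul_right _ h4
      _ = n ^ 2 * (36 * (6 * L n + 3 + 2)) := by ring
      _ ≤ n ^ 2 * (768 * L n + 352) := Nat.mul_le_mul_left _ (by omega)
end
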